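/- Let {Y ∪ {Δ}, A, p} be an MDP model that satisfies Condition (S) and is absorbing with a given initial state x0. Then a sequence {η_n}_{n≥1} ⊆ D^Π_{x0} converges to some η ∈ D^Π_{x0} in the w-topology if and only if η_n → η in the ws-topology. -/

import Mathlib

open MeasureTheory ProbabilityTheory Filter Topology
open scoped ENNReal

noncomputable section

/-! ### General MDP framework

The state space of an absorbing-type MDP model is `X = Y ⊕ Unit`, where `Sum.inr ()` plays
the role of the isolated cemetery point `Δ` and `Y` is embedded via `Sum.inl`.

A history up to stage `n` is `h_n = (x_0, a_1, x_1, …, a_n, x_n)`, which we encode as the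
list of pairs `(x_k, a_{k+1})`, `k < n`, together with the last state `x_n`. -/

/-- The space `H_n` of histories up to stage `n`. -/
abbrev Hist (X A : Type*) (n : ℕ) : Type _ := (Fin n → X × A) × X

/-- A strategy: for every `n`, a stochastic (Markov) kernel on `A` given `H_n`,
prescribing the law of the action `a_{n+1}` given the history `h_n`. -/
def Strategy (X A : Type*) [MeasurableSpace X] [MeasurableSpace A] : Type _ :=
  {π : (n : ℕ) → Kernel (Hist X A n) A // ∀ n, IsMarkovKernel (π n)}

variable {X A Y : Type*} [MeasurableSpace X] [MeasurableSpace A] [MeasurableSpace Y]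

/-- The finite-dimensional distributions of the strategic measure `P^π_{x0}`:
`histLaw p π x0 n` is the joint law of `(X_0, A_1, …, A_n, X_n)` under `P^π_{x0}`,
built by the Ionescu-Tulcea recursion. -/
def histLaw (p : Kernel (X × A) X) (π : Strategy X A) (x0 : X) :
    (n : ℕ) → Measure (Hist X A n)
  | 0 => Measure.dirac (fun i => i.elim0, x0)
  | n + 1 =>
      (histLaw p π x0 n).bind fun h =>
        ((π.1 n) h).bind fun a =>
          (p (h.2, a)).map fun x' => (Fin.snoc h.1 (h.2, a), x')

/-- The law of the pair `(X_n, A_{n+1})` under the strategic measure `P^π_{x0}`. -/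
def pairLaw (p : Kernel (X × A) X) (π : Strategy X A) (x0 : X) (n : ℕ) :
    Measure (X × A) :=
  (histLaw p π x0 n).bind fun h => ((π.1 n) h).map fun a => (h.2, a)

/-- The occupation measure `η^π_{x0}` on `Y × A`:
`η^π_{x0}(dx × da) = Σ_n P^π_{x0}(X_n ∈ dx ∩ Y, A_{n+1} ∈ da)`. -/
def occupation (p : Kernel ((Y ⊕ Unit) × A) (Y ⊕ Unit)) (π : Strategy (Y ⊕ Unit) A)
    (x0 : Y ⊕ Unit) : Measure (Y × A) :=
  Measure.sum fun n => (pairLaw p π x0 n).comap fun ya : Y × A => (Sum.inl ya.1, ya.2)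

/-- `P^π_{x0}(X_t ∈ Y)`.  Since the cemetery `Δ` is absorbing, this equals the tail
probability `P^π_{x0}(τ > t)` of the hitting time `τ` of `Δ`. -/
def survive (p : Kernel ((Y ⊕ Unit) × A) (Y ⊕ Unit)) (π : Strategy (Y ⊕ Unit) A)
    (x0 : Y ⊕ Unit) (t : ℕ) : ℝ≥0∞ :=
  pairLaw p π x0 t {z | ∃ y : Y, z.1 = Sum.inl y}

/-- The model is absorbing with initial state `x0`:
`E^π_{x0}[τ] = Σ_t P^π_{x0}(τ > t) < ∞` for every strategy `π`. -/
def IsAbsorbing (p : Kernel ((Y ⊕ Unit) × A) (Y ⊕ Unit)) (x0 : Y ⊕ Unit) : Prop :=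
  ∀ π : Strategy (Y ⊕ Unit) A, ∑' t : ℕ, survive p π x0 t < ⊤

/-- The model is `Λ`-uniformly absorbing with initial state `x0`:
`sup_{π ∈ Λ} E^π_{x0}[Σ_{t=n}^∞ 1{τ > t}] = sup_{π ∈ Λ} Σ_{t ≥ n} P^π_{x0}(τ > t) → 0`. -/
def IsUnifAbsorbing (p : Kernel ((Y ⊕ Unit) × A) (Y ⊕ Unit))
    (Λ : Set (Strategy (Y ⊕ Unit) A)) (x0 : Y ⊕ Unit) : Prop :=
  Tendsto (fun n : ℕ => ⨆ π ∈ Λ, ∑' t : ℕ, survive p π x0 (n + t)) atTop (𝓝 0)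

/-- The set `D^Λ_{x0} ⊆ M(Y × A)` of occupation measures of strategies in `Λ`. -/
def OccSet (p : Kernel ((Y ⊕ Unit) × A) (Y ⊕ Unit)) (Λ : Set (Strategy (Y ⊕ Unit) A))
    (x0 : Y ⊕ Unit) : Set (FiniteMeasure (Y × A)) :=
  {η | ∃ π ∈ Λ, (η : Measure (Y × A)) = occupation p π x0}

/-- Condition (S): the action space is compact and `a ↦ ∫ g dp(·|x,a)` is continuous for
every bounded measurable `g` and every state `x`. -/
def ConditionS [TopologicalSpace A] (p : Kernel (X × A) X) : Prop :=
  CompactSpace A ∧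
    ∀ g : X → ℝ, Measurable g → (∃ C, ∀ x, |g x| ≤ C) →
      ∀ x : X, Continuous fun a : A => ∫ y, g y ∂(p (x, a))

/-- Condition (W): the action space is compact and `(x,a) ↦ ∫ g dp(·|x,a)` is continuous for
every bounded continuous `g`. -/
def ConditionW [TopologicalSpace X] [TopologicalSpace A] (p : Kernel (X × A) X) : Prop :=
  CompactSpace A ∧
    ∀ g : X → ℝ, Continuous g → (∃ C, ∀ x, |g x| ≤ C) →
      Continuous fun xa : X × A => ∫ y, g y ∂(p xa)

/-- The w-topology on `M(Ω)`: the coarsest topology making `η ↦ ∫ g dη` continuous for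
every bounded continuous `g : Ω → ℝ`. -/
def wTop (Ω : Type*) [TopologicalSpace Ω] [MeasurableSpace Ω] :
    TopologicalSpace (FiniteMeasure Ω) :=
  ⨅ (g : Ω → ℝ) (_ : Continuous g) (_ : ∃ C, ∀ z, |g z| ≤ C),
    TopologicalSpace.induced (fun η : FiniteMeasure Ω => ∫ z, g z ∂(η : Measure Ω))
      inferInstance

/-- The ws-topology on `M(Y × A)`: the coarsest topology making `η ↦ ∫ g dη` continuous for
every bounded Caratheodory function `g : Y × A → ℝ`. -/
def wsTop (Y A : Type*) [MeasurableSpace Y] [TopologicalSpace A] [MeasurableSpace A] :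
    TopologicalSpace (FiniteMeasure (Y × A)) :=
  ⨅ (g : Y × A → ℝ) (_ : Measurable g) (_ : ∃ C, ∀ z, |g z| ≤ C)
    (_ : ∀ y : Y, Continuous fun a : A => g (y, a)),
    TopologicalSpace.induced (fun η : FiniteMeasure (Y × A) => ∫ z, g z ∂(η : Measure (Y × A)))
      inferInstance

/-- The s-topology on `M(Y)`: the coarsest topology making `η ↦ ∫ f dη` continuous for
every bounded measurable `f : Y → ℝ`. -/
def sTop (Y : Type*) [MeasurableSpace Y] : TopologicalSpace (FiniteMeasure Y) :=
  ⨅ (f : Y → ℝ) (_ : Measurable f) (_ : ∃ C, ∀ z, |f z| ≤ C),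
    TopologicalSpace.induced (fun η : FiniteMeasure Y => ∫ z, f z ∂(η : Measure Y))
      inferInstance

theorem standardBorelSpace_sum {α β : Type*} [MeasurableSpace α] [MeasurableSpace β]
    [StandardBorelSpace α] [StandardBorelSpace β] : StandardBorelSpace (α ⊕ β) := by
  let := upgradeStandardBorel α
  let := upgradeStandardBorel β
  have : BorelSpace (α ⊕ β) := by
    refine ⟨le_antisymm ?_ ?_⟩
    · intro s hs
      have hs' : MeasurableSet[Sum.instMeasurableSpace] s := hs
      rw [measurableSet_sum_iff] at hs'
      let : MeasurableSpace (α ⊕ β) := borel _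
      have : BorelSpace (α ⊕ β) := ⟨rfl⟩
      have h : s = Sum.inl '' (Sum.inl ⁻¹' s) ∪ Sum.inr '' (Sum.inr ⁻¹' s) := by
        ext x; cases x <;> simp
      rw [h]
      exact (IsOpenEmbedding.inl.measurableEmbedding.measurableSet_image' hs'.1).union
        (IsOpenEmbedding.inr.measurableEmbedding.measurableSet_image' hs'.2)
    · refine MeasurableSpace.generateFrom_le fun s hs => ?_
      rw [measurableSet_sum_iff]
      exact ⟨(hs.preimage continuous_inl).measurableSet, (hs.preimage continuous_inr).measurableSet⟩
  infer_instance

theorem measurable_of_measurable_dist {X E : Type*} [MeasurableSpace X] [PseudoMetricSpace E]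
    [SecondCountableTopology E] [MeasurableSpace E] [BorelSpace E] {f : X → E}
    (h : ∀ c, Measurable fun x => dist (f x) c) : Measurable f := by
  have hb : TopologicalSpace.IsTopologicalBasis {s : Set E | ∃ c r, s = Metric.ball c r} := by
    refine TopologicalSpace.isTopologicalBasis_of_isOpen_of_nhds ?_ ?_
    · rintro _ ⟨c, r, rfl⟩; exact Metric.isOpen_ball
    · intro a u ha hu
      obtain ⟨r, hr, hs⟩ := Metric.isOpen_iff.1 hu a ha
      exact ⟨_, ⟨a, r, rfl⟩, Metric.mem_ball_self hr, hs⟩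
  rw [BorelSpace.measurable_eq (α := E), hb.borel_eq_generateFrom]
  refine measurable_generateFrom ?_
  rintro _ ⟨c, r, rfl⟩
  exact measurableSet_lt (h c) measurable_const

theorem stronglyMeasurable_continuousMap {X A : Type*} [MeasurableSpace X] [TopologicalSpace A]
    [CompactSpace A] [SecondCountableTopology A] [TopologicalSpace.MetrizableSpace A]
    {f : X → C(A, ℝ)} (h : ∀ a, Measurable fun x => f x a) : StronglyMeasurable f := by
  let : MeasurableSpace C(A, ℝ) := borel _
  have : BorelSpace C(A, ℝ) := ⟨rfl⟩
  refine (measurable_of_measurable_dist fun c => measurable_of_Iic fun r => ?_).stronglyMeasurable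
  obtain ⟨s, hs, hd⟩ := TopologicalSpace.exists_countable_dense A
  rcases lt_or_ge r 0 with hr | hr
  · have : (fun x => dist (f x) c) ⁻¹' Set.Iic r = ∅ := by
      ext x
      simpa using hr.trans_le dist_nonneg
    simp [this]
  · have : (fun x => dist (f x) c) ⁻¹' Set.Iic r = ⋂ a ∈ s, {x | dist (f x a) (c a) ≤ r} := by
      ext x
      simp only [Set.mem_preimage, Set.mem_Iic, Set.mem_iInter, Set.mem_ofPred_eq]
      rw [ContinuousMap.dist_le hr]
      refine ⟨fun h a _ => h a, fun h a => ?_⟩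
      have hc : IsClosed {a | dist (f x a) (c a) ≤ r} :=
        isClosed_le (by fun_prop) continuous_const
      exact hc.closure_subset_iff.2 (fun a ha => h a ha) (hd a)
    rw [this]
    refine MeasurableSet.biInter hs fun a _ => ?_
    exact measurableSet_le ((h a).dist measurable_const) measurable_const

theorem map_prodMap_comap_of_ae {X K A : Type*} [MeasurableSpace X] [MeasurableSpace K]
    [MeasurableSpace A] {e : X → K} (he : MeasurableEmbedding e) {m : Measure X}
    {L : Measure (K × A)} (hL : L.fst = m.map e) :
    ((L.comap (Prod.map e id)).map (Prod.map e id)) = L := by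
  have hp : MeasurableEmbedding (Prod.map e (id : A → A)) := he.prodMap MeasurableEmbedding.id
  rw [hp.map_comap, Measure.restrict_eq_self_of_ae_mem]
  have h : L.fst (Set.range e)ᶜ = 0 := by
    rw [hL, he.map_apply]
    simp
  rw [Measure.fst_apply he.measurableSet_range.compl] at h
  refine measure_mono_null (fun z hz => ?_) h
  simp only [Set.range_prodMap, Set.range_id, Set.mem_prod, Set.mem_univ, and_true,
    Set.mem_compl_iff, Set.mem_ofPred_eq, Set.mem_preimage] at hz ⊢
  exact hz

theorem integral_norm_sub_comp_fst {X A : Type*} [MeasurableSpace X] [MeasurableSpace A]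
    {N : Measure (X × A)} [IsProbabilityMeasure N] {g f : X × A → ℝ} {r : X → ℝ}
    (hg : Integrable g N) (hf : Integrable f N) (hr : Integrable r N.fst)
    (h : ∀ z, |g z - f z| ≤ r z.1) : |∫ z, g z ∂N - ∫ z, f z ∂N| ≤ ∫ x, r x ∂N.fst := by
  rw [← integral_sub hg hf, Measure.fst, integral_map measurable_fst.aemeasurable hr.1]
  refine (abs_integral_le_integral_abs).trans (integral_mono (hg.sub hf).abs ?_ h)
  exact hr.comp_measurable measurable_fst

/-- Setwise convergence of the first marginals upgrades weak convergence to convergence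
against bounded Caratheodory functions. -/
theorem tendsto_integral_caratheodory {X K A ι : Type*} [MeasurableSpace X]
    [TopologicalSpace K] [CompactSpace K] [TopologicalSpace.MetrizableSpace K]
    [SecondCountableTopology K] [MeasurableSpace K] [BorelSpace K]
    [TopologicalSpace A] [CompactSpace A] [TopologicalSpace.MetrizableSpace A]
    [SecondCountableTopology A] [MeasurableSpace A] [BorelSpace A]
    {e : X → K} (he : MeasurableEmbedding e) {l : Filter ι}
    {N : ι → Measure (X × A)} [∀ i, IsProbabilityMeasure (N i)]
    {N' : Measure (X × A)} [IsProbabilityMeasure N']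
    (hw : ∀ F : K × A → ℝ, Continuous F →
      Tendsto (fun i => ∫ z, F (e z.1, z.2) ∂(N i)) l (𝓝 (∫ z, F (e z.1, z.2) ∂N')))
    (hs : ∀ f : X → ℝ, Measurable f → (∃ C, ∀ x, |f x| ≤ C) →
      Tendsto (fun i => ∫ x, f x ∂(N i).fst) l (𝓝 (∫ x, f x ∂N'.fst)))
    {g : X × A → ℝ} (hg : Measurable g) {C : ℝ} (hC : ∀ z, |g z| ≤ C)
    (hgc : ∀ x, Continuous fun a => g (x, a)) :
    Tendsto (fun i => ∫ z, g z ∂(N i)) l (𝓝 (∫ z, g z ∂N')) := by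
  let G : X → C(A, ℝ) := fun x => ⟨fun a => g (x, a), hgc x⟩
  have hG : StronglyMeasurable G := stronglyMeasurable_continuousMap fun a =>
    hg.comp measurable_prodMk_right
  let H : K → C(A, ℝ) := Function.extend e G 0
  have hH : StronglyMeasurable H := by
    let : MeasurableSpace C(A, ℝ) := borel _
    have : BorelSpace C(A, ℝ) := ⟨rfl⟩
    exact (he.measurable_extend hG.measurable measurable_zero).stronglyMeasurable
  have hHe : ∀ x, H (e x) = G x := fun x => he.injective.extend_apply _ _ _
  have : IsProbabilityMeasure (N'.fst.map e) :=
    Measure.isProbabilityMeasure_map he.measurable.aemeasurable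
  have hGC : ∀ x, ‖G x‖ ≤ |C| := fun x =>
    (ContinuousMap.norm_le _ (abs_nonneg C)).2 fun a => (hC (x, a)).trans (le_abs_self C)
  have hHi : Integrable H (N'.fst.map e) := by
    refine Integrable.of_bound hH.aestronglyMeasurable |C| ?_
    rw [he.ae_map_iff]
    exact Eventually.of_forall fun x => by rw [hHe]; exact hGC x
  rw [Metric.tendsto_nhds]
  intro ε hε
  obtain ⟨F, hF, -⟩ := hHi.exists_boundedContinuous_integral_sub_le (ε := ε / 4) (by positivity)
  let f : K × A → ℝ := fun z => F z.1 z.2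
  have hf : Continuous f := by
    have : Continuous fun z : C(A, ℝ) × A => z.1 z.2 := by fun_prop
    exact this.comp ((F.continuous.comp continuous_fst).prodMk continuous_snd)
  obtain ⟨D, hD⟩ : ∃ D, ∀ z, |f z| ≤ D := by
    obtain ⟨D, hD⟩ := isCompact_univ.exists_bound_of_continuousOn hf.continuousOn
    exact ⟨D, fun z => hD z trivial⟩
  let r : X → ℝ := fun x => ‖G x - F (e x)‖
  have hr : Measurable r := by
    refine (StronglyMeasurable.norm (hG.sub ?_)).measurable
    exact F.continuous.stronglyMeasurable.comp_measurable he.measurable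
  have hrC : ∀ x, |r x| ≤ |C| + ‖F‖ := fun x => by
    rw [abs_of_nonneg (norm_nonneg _)]
    exact (norm_sub_le _ _).trans (add_le_add (hGC x) (F.norm_coe_le_norm _))
  have hrε : ∫ x, r x ∂N'.fst ≤ ε / 4 := by
    rw [he.integral_map] at hF
    simpa [hHe, r] using hF
  have hbound : ∀ (M : Measure (X × A)) [IsProbabilityMeasure M],
      |∫ z, g z ∂M - ∫ z, f (e z.1, z.2) ∂M| ≤ ∫ x, r x ∂M.fst := by
    intro M _
    refine integral_norm_sub_comp_fst ?_ ?_ ?_ ?_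
    · exact Integrable.of_bound hg.aestronglyMeasurable C (Eventually.of_forall hC)
    · refine Integrable.of_bound (Measurable.aestronglyMeasurable ?_) D
        (Eventually.of_forall fun z => hD _)
      exact hf.measurable.comp ((he.measurable.comp measurable_fst).prodMk measurable_snd)
    · exact Integrable.of_bound hr.aestronglyMeasurable _ (Eventually.of_forall hrC)
    · intro z
      exact (G z.1 - F (e z.1)).norm_coe_le_norm z.2
  filter_upwards [(Metric.tendsto_nhds.1 (hs r hr ⟨_, hrC⟩)) (ε / 4) (by positivity),
    (Metric.tendsto_nhds.1 (hw f hf)) (ε / 4) (by positivity)] with i h1 h2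
  have h3 := hbound (N i)
  have h4 := hbound N'
  rw [Real.dist_eq] at h1 h2 ⊢
  rw [abs_lt] at *
  rw [abs_le] at *
  constructor <;> linarith

/-- Relative compactness of probability measures on `X × A` with setwise convergent
marginals on `X`, for convergence against bounded Caratheodory functions. -/
theorem exists_caratheodory_limit {X A ι : Type*} [MeasurableSpace X] [StandardBorelSpace X]
    [TopologicalSpace A] [CompactSpace A] [TopologicalSpace.MetrizableSpace A]
    [SecondCountableTopology A] [MeasurableSpace A] [BorelSpace A]
    (U : Ultrafilter ι) (N : ι → Measure (X × A)) [∀ i, IsProbabilityMeasure (N i)] :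
    ∃ N' : Measure (X × A), ∀ m : Measure X, IsProbabilityMeasure m →
      (∀ f : X → ℝ, Measurable f → (∃ C, ∀ x, |f x| ≤ C) →
        Tendsto (fun i => ∫ x, f x ∂(N i).fst) U (𝓝 (∫ x, f x ∂m))) →
      IsProbabilityMeasure N' ∧ N'.fst = m ∧
      ∀ g : X × A → ℝ, Measurable g → (∃ C, ∀ z, |g z| ≤ C) →
        (∀ x, Continuous fun a => g (x, a)) →
        Tendsto (fun i => ∫ z, g z ∂(N i)) U (𝓝 (∫ z, g z ∂N')) := by
  have he := measurableEmbedding_sigmoid_comp_embeddingReal X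
  set e : X → unitInterval := unitInterval.sigmoid ∘ embeddingReal X
  have hp : MeasurableEmbedding (Prod.map e (id : A → A)) := he.prodMap MeasurableEmbedding.id
  let P : ι → ProbabilityMeasure (unitInterval × A) := fun i =>
    ⟨(N i).map (Prod.map e id), Measure.isProbabilityMeasure_map hp.measurable.aemeasurable⟩
  obtain ⟨L, -, hL⟩ := isCompact_univ.ultrafilter_le_nhds (U.map P) (by simp)
  have hL : Tendsto P U (𝓝 L) := hL
  rw [ProbabilityMeasure.tendsto_iff_forall_integral_tendsto] at hL
  refine ⟨(L : Measure (unitInterval × A)).comap (Prod.map e id), fun m hm hs => ?_⟩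
  set N' := (L : Measure (unitInterval × A)).comap (Prod.map e id) with hN'
  have hfst : (L : Measure (unitInterval × A)).fst = m.map e := by
    have : IsProbabilityMeasure (m.map e) :=
      Measure.isProbabilityMeasure_map he.measurable.aemeasurable
    refine ext_of_forall_integral_eq_of_IsFiniteMeasure fun f => ?_
    have hfe : Measurable fun x => f (e x) := f.continuous.measurable.comp he.measurable
    have h1 := hL (f.compContinuous ⟨Prod.fst, continuous_fst⟩)
    have h2 := hs _ hfe
      ⟨‖f‖, fun x => f.norm_coe_le_norm _⟩
    rw [Measure.fst, integral_map measurable_fst.aemeasurable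
      f.continuous.measurable.aestronglyMeasurable, he.integral_map]
    refine tendsto_nhds_unique h1 (h2.congr fun i => ?_)
    change _ = ∫ z, f z.1 ∂((N i).map (Prod.map e id))
    rw [hp.integral_map, Measure.fst, integral_map measurable_fst.aemeasurable
      hfe.aestronglyMeasurable]
    rfl
  have hmap : N'.map (Prod.map e id) = L := map_prodMap_comap_of_ae he hfst
  have hprob : IsProbabilityMeasure N' := by
    refine ⟨?_⟩
    have : (N'.map (Prod.map e id)) Set.univ = 1 := by rw [hmap]; exact measure_univ
    rwa [hp.map_apply, Set.preimage_univ] at this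
  have hm' : N'.fst = m := by
    have : (N'.fst).map e = m.map e := by
      rw [← hfst, ← hmap, Measure.fst, Measure.fst, Measure.map_map he.measurable measurable_fst,
        Measure.map_map measurable_fst hp.measurable]
      rfl
    rw [← he.comap_map N'.fst, this, he.comap_map]
  refine ⟨hprob, hm', fun g hg ⟨C, hC⟩ hgc => ?_⟩
  refine tendsto_integral_caratheodory he (fun F hF => ?_) (hm' ▸ hs) hg hC hgc
  have h := hL (BoundedContinuousFunction.mkOfCompact ⟨F, hF⟩)
  rw [← hmap, hp.integral_map] at h
  refine h.congr fun i => ?_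
  change ∫ z, F z ∂((N i).map (Prod.map e id)) = _
  rw [hp.integral_map]
  rfl

theorem integral_bind_kernel {α β : Type*} [MeasurableSpace α] [MeasurableSpace β]
    {μ : Measure α} [SFinite μ] (κ : Kernel α β) [IsSFiniteKernel κ] {f : β → ℝ}
    (hf : Integrable f (μ.bind κ)) : ∫ y, f y ∂(μ.bind κ) = ∫ x, ∫ y, f y ∂(κ x) ∂μ := by
  rw [Measure.comp_eq_comp_const_apply] at hf ⊢
  rw [Kernel.integral_comp hf, Kernel.const_apply]

/-- The laws of `(X_t, A_{t+1})`, `t ≥ 0`, under some strategy satisfy these relations. -/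
structure IsMarginalFlow {X A : Type*} [MeasurableSpace X] [MeasurableSpace A]
    (p : Kernel (X × A) X) (x0 : X) (M : ℕ → Measure (X × A)) : Prop where
  prob : ∀ t, IsProbabilityMeasure (M t)
  zero : (M 0).fst = Measure.dirac x0
  succ : ∀ t, (M (t + 1)).fst = (M t).bind p

theorem exists_marginalFlow_limit {X A ι : Type*} [MeasurableSpace X] [StandardBorelSpace X]
    [TopologicalSpace A] [CompactSpace A] [TopologicalSpace.MetrizableSpace A]
    [SecondCountableTopology A] [MeasurableSpace A] [BorelSpace A]
    (p : Kernel (X × A) X) [IsMarkovKernel p]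
    (hp : ∀ g : X → ℝ, Measurable g → (∃ C, ∀ x, |g x| ≤ C) →
      ∀ x : X, Continuous fun a : A => ∫ y, g y ∂(p (x, a)))
    (x0 : X) (U : Ultrafilter ι) (M : ι → ℕ → Measure (X × A))
    (hM : ∀ i, IsMarginalFlow p x0 (M i)) :
    ∃ M', IsMarginalFlow p x0 M' ∧ ∀ t, ∀ g : X × A → ℝ, Measurable g → (∃ C, ∀ z, |g z| ≤ C) →
        (∀ x, Continuous fun a => g (x, a)) →
        Tendsto (fun i => ∫ z, g z ∂(M i t)) U (𝓝 (∫ z, g z ∂(M' t))) := by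
  have hMp : ∀ t i, IsProbabilityMeasure (M i t) := fun t i => (hM i).prob t
  choose M' hM' using fun t => exists_caratheodory_limit U (fun i => M i t)
  have h0 := hM' 0 (Measure.dirac x0) inferInstance fun f hf _ => by
    simp [(hM _).zero]
  have hsucc : ∀ t, IsProbabilityMeasure (M' t) → (∀ g : X × A → ℝ, Measurable g →
      (∃ C, ∀ z, |g z| ≤ C) → (∀ x, Continuous fun a => g (x, a)) →
        Tendsto (fun i => ∫ z, g z ∂(M i t)) U (𝓝 (∫ z, g z ∂(M' t)))) →
      ∀ f : X → ℝ, Measurable f → (∃ C, ∀ x, |f x| ≤ C) →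
        Tendsto (fun i => ∫ x, f x ∂(M i (t + 1)).fst) U (𝓝 (∫ x, f x ∂((M' t).bind p))) := by
    intro t _ h f hf ⟨C, hC⟩
    have hint : ∀ (μ : Measure X) [IsFiniteMeasure μ], Integrable f μ := fun μ _ =>
      Integrable.of_bound hf.aestronglyMeasurable C (Eventually.of_forall hC)
    have := h (fun z => ∫ y, f y ∂(p z)) hf.stronglyMeasurable.integral_kernel.measurable
      ⟨C, fun z => by
        simpa using norm_integral_le_of_norm_le_const (μ := p z) (f := f) (Eventually.of_forall hC)⟩
      (hp f hf ⟨C, hC⟩)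
    rw [integral_bind_kernel p (hint _)]
    refine this.congr fun i => ?_
    rw [(hM i).succ t, integral_bind_kernel p (hint _)]
  have hall : ∀ t, IsProbabilityMeasure (M' t) ∧ (∀ g : X × A → ℝ, Measurable g →
      (∃ C, ∀ z, |g z| ≤ C) → (∀ x, Continuous fun a => g (x, a)) →
        Tendsto (fun i => ∫ z, g z ∂(M i t)) U (𝓝 (∫ z, g z ∂(M' t)))) := by
    intro t
    induction t with
    | zero => exact ⟨h0.1, h0.2.2⟩
    | succ t ih =>
      have := ih.1
      have h := hM' (t + 1) ((M' t).bind p) inferInstance (hsucc t ih.1 ih.2)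
      exact ⟨h.1, h.2.2⟩
  refine ⟨M', ⟨fun t => (hall t).1, h0.2.1, fun t => ?_⟩, fun t => (hall t).2⟩
  have := (hall t).1
  exact (hM' (t + 1) ((M' t).bind p) inferInstance (hsucc t (hall t).1 (hall t).2)).2.1

theorem measurable_bind_kernel {α β γ : Type*} [MeasurableSpace α] [MeasurableSpace β]
    [MeasurableSpace γ] (κ : Kernel α β) [IsSFiniteKernel κ] {K : α × β → Measure γ}
    (hK : Measurable K) : Measurable fun a => (κ a).bind fun b => K (a, b) := by
  refine Measure.measurable_of_measurable_coe _ fun s hs => ?_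
  have h : ∀ a, (κ a).bind (fun b => K (a, b)) s = ∫⁻ b, K (a, b) s ∂(κ a) := fun a =>
    Measure.bind_apply hs (hK.comp measurable_prodMk_left).aemeasurable
  simp_rw [h]
  exact ((Measure.measurable_coe hs).comp hK).lintegral_kernel_prod_right'

theorem measurable_map_kernel {α β γ : Type*} [MeasurableSpace α] [MeasurableSpace β]
    [MeasurableSpace γ] (κ : Kernel α β) [IsSFiniteKernel κ] {f : α × β → γ}
    (hf : Measurable f) : Measurable fun a => (κ a).map fun b => f (a, b) := by
  refine Measure.measurable_of_measurable_coe _ fun s hs => ?_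
  have h : ∀ a, (κ a).map (fun b => f (a, b)) s = κ a (Prod.mk a ⁻¹' (f ⁻¹' s)) := fun a =>
    Measure.map_apply (hf.comp measurable_prodMk_left) hs
  simp_rw [h]
  exact Kernel.measurable_kernel_prodMk_left (hf hs)

theorem measurable_fin_snoc (X A : Type*) [MeasurableSpace X] [MeasurableSpace A] (n : ℕ) :
    Measurable fun z : (Hist X A n × A) × X =>
      ((Fin.snoc z.1.1.1 (z.1.1.2, z.1.2), z.2) : Hist X A (n + 1)) := by
  refine Measurable.prodMk (measurable_pi_iff.2 fun i => ?_) measurable_snd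
  refine Fin.lastCases ?_ (fun i => ?_) i
  · simp only [Fin.snoc_last]
    fun_prop
  · simp only [Fin.snoc_castSucc]
    fun_prop

theorem lintegral_bind_bind_map {α β γ δ : Type*} [MeasurableSpace α] [MeasurableSpace β]
    [MeasurableSpace γ] [MeasurableSpace δ] (μ : Measure α) (κ : Kernel α β) [IsSFiniteKernel κ]
    (q : Kernel (α × β) γ) [IsSFiniteKernel q] {F : (α × β) × γ → δ} (hF : Measurable F)
    {f : δ → ℝ≥0∞} (hf : Measurable f) :
    ∫⁻ d, f d ∂(μ.bind fun a => (κ a).bind fun b => (q (a, b)).map fun c => F ((a, b), c)) =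
      ∫⁻ a, ∫⁻ b, ∫⁻ c, f (F ((a, b), c)) ∂(q (a, b)) ∂(κ a) ∂μ := by
  have hK := measurable_map_kernel q hF
  rw [Measure.lintegral_bind (measurable_bind_kernel κ hK).aemeasurable hf.aemeasurable]
  refine lintegral_congr fun a => ?_
  refine (Measure.lintegral_bind (hK.comp measurable_prodMk_left).aemeasurable
    hf.aemeasurable).trans (lintegral_congr fun b => ?_)
  exact lintegral_map hf (hF.comp measurable_prodMk_left)

theorem lintegral_histLaw_succ (p : Kernel (X × A) X) [IsMarkovKernel p] (π : Strategy X A)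
    (x0 : X) (n : ℕ) {f : Hist X A (n + 1) → ℝ≥0∞} (hf : Measurable f) :
    ∫⁻ h, f h ∂(histLaw p π x0 (n + 1)) =
      ∫⁻ h, ∫⁻ a, ∫⁻ x', f (Fin.snoc h.1 (h.2, a), x') ∂(p (h.2, a)) ∂(π.1 n h)
        ∂(histLaw p π x0 n) := by
  have := π.2 n
  rw [histLaw]
  exact lintegral_bind_bind_map (histLaw p π x0 n) (π.1 n)
    (p.comap (fun z : Hist X A n × A => (z.1.2, z.2)) (by fun_prop))
    (measurable_fin_snoc X A n) hf

theorem lintegral_pairLaw (p : Kernel (X × A) X) (π : Strategy X A)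
    (x0 : X) (n : ℕ) {f : X × A → ℝ≥0∞} (hf : Measurable f) :
    ∫⁻ z, f z ∂(pairLaw p π x0 n) =
      ∫⁻ h, ∫⁻ a, f (h.2, a) ∂(π.1 n h) ∂(histLaw p π x0 n) := by
  have := π.2 n
  have hm : Measurable fun z : Hist X A n × A => (z.1.2, z.2) := by fun_prop
  refine (Measure.lintegral_bind (measurable_map_kernel (π.1 n) hm).aemeasurable
    hf.aemeasurable).trans (lintegral_congr fun h => ?_)
  exact lintegral_map hf (hm.comp (measurable_prodMk_left (x := h)))

theorem isProbabilityMeasure_histLaw (p : Kernel (X × A) X) [IsMarkovKernel p]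
    (π : Strategy X A) (x0 : X) (n : ℕ) : IsProbabilityMeasure (histLaw p π x0 n) := by
  induction n with
  | zero => rw [histLaw]; infer_instance
  | succ n ih =>
    have := π.2 n
    refine ⟨?_⟩
    rw [← lintegral_one, lintegral_histLaw_succ p π x0 n measurable_const]
    simp

theorem lintegral_pairLaw_fst (p : Kernel (X × A) X) (π : Strategy X A)
    (x0 : X) (n : ℕ) {f : X → ℝ≥0∞} (hf : Measurable f) :
    ∫⁻ x, f x ∂(pairLaw p π x0 n).fst = ∫⁻ h, f h.2 ∂(histLaw p π x0 n) := by
  have := π.2 n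
  rw [Measure.fst, lintegral_map hf measurable_fst]
  refine (lintegral_pairLaw p π x0 n (hf.comp measurable_fst)).trans ?_
  simp

theorem isMarginalFlow_pairLaw (p : Kernel (X × A) X) [IsMarkovKernel p] (π : Strategy X A)
    (x0 : X) : IsMarginalFlow p x0 (pairLaw p π x0) where
  prob t := by
    have := π.2 t
    have := isProbabilityMeasure_histLaw p π x0 t
    refine ⟨?_⟩
    rw [← lintegral_one, lintegral_pairLaw p π x0 t measurable_const]
    simp
  zero := by
    refine Measure.ext_of_lintegral _ fun f hf => ?_
    rw [lintegral_pairLaw_fst p π x0 0 hf, lintegral_dirac' _ hf]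
    exact lintegral_dirac' _ (hf.comp measurable_snd)
  succ t := by
    have := π.2 t
    refine Measure.ext_of_lintegral _ fun f hf => ?_
    rw [lintegral_pairLaw_fst p π x0 _ hf,
      Measure.lintegral_bind p.measurable.aemeasurable hf.aemeasurable,
      lintegral_pairLaw p π x0 t hf.lintegral_kernel]
    exact lintegral_histLaw_succ p π x0 t (hf.comp measurable_snd)

/-- Follow `π` before stage `t`, and the stationary policy `σ` from stage `t` on. -/
def Strategy.switch (π : Strategy X A) (t : ℕ) (σ : Kernel X A) [IsMarkovKernel σ] :
    Strategy X A :=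
  ⟨fun n => if n < t then π.1 n else σ.comap Prod.snd measurable_snd, fun n => by
    have := π.2 n
    dsimp only
    split_ifs <;> infer_instance⟩

theorem histLaw_switch (p : Kernel (X × A) X) (π : Strategy X A) (x0 : X) (t : ℕ)
    (σ : Kernel X A) [IsMarkovKernel σ] {n : ℕ} (hn : n ≤ t) :
    histLaw p (π.switch t σ) x0 n = histLaw p π x0 n := by
  induction n with
  | zero => rfl
  | succ n ih =>
    have h : (π.switch t σ).1 n = π.1 n := if_pos hn
    rw [histLaw, histLaw, ih (by omega), h]

theorem pairLaw_switch_fst (p : Kernel (X × A) X) (π : Strategy X A) (x0 : X) (t : ℕ)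
    (σ : Kernel X A) [IsMarkovKernel σ] :
    (pairLaw p (π.switch t σ) x0 t).fst = (pairLaw p π x0 t).fst := by
  refine Measure.ext_of_lintegral _ fun f hf => ?_
  rw [lintegral_pairLaw_fst p _ x0 t hf, lintegral_pairLaw_fst p _ x0 t hf,
    histLaw_switch p π x0 t σ le_rfl]

theorem lintegral_pairLaw_switch (p : Kernel (X × A) X) (π : Strategy X A) (x0 : X) {t n : ℕ}
    (σ : Kernel X A) [IsMarkovKernel σ] (hn : t ≤ n) {f : X × A → ℝ≥0∞} (hf : Measurable f) :
    ∫⁻ z, f z ∂(pairLaw p (π.switch t σ) x0 n) =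
      ∫⁻ x, ∫⁻ a, f (x, a) ∂(σ x) ∂(pairLaw p (π.switch t σ) x0 n).fst := by
  have h : (π.switch t σ).1 n = σ.comap Prod.snd measurable_snd := if_neg (by omega)
  rw [lintegral_pairLaw p _ x0 n hf, lintegral_pairLaw_fst p _ x0 n hf.lintegral_kernel_prod_right',
    h]
  simp

/-- Probability of being in `S` after `k` steps under the stationary policy `σ`. -/
def stayProb (p : Kernel (X × A) X) (σ : Kernel X A) (S : Set X) : ℕ → X → ℝ≥0∞
  | 0 => S.indicator 1
  | k + 1 => fun x => ∫⁻ a, ∫⁻ x', stayProb p σ S k x' ∂(p (x, a)) ∂(σ x)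

theorem measurable_stayProb (p : Kernel (X × A) X) (σ : Kernel X A) [IsMarkovKernel σ] {S : Set X}
    (hS : MeasurableSet S) (k : ℕ) : Measurable (stayProb p σ S k) := by
  induction k with
  | zero => exact measurable_one.indicator hS
  | succ k ih => exact (ih.lintegral_kernel (κ := p)).lintegral_kernel_prod_right'

theorem stayProb_le_one (p : Kernel (X × A) X) [IsMarkovKernel p] (σ : Kernel X A)
    [IsMarkovKernel σ] (S : Set X) (k : ℕ) (x : X) : stayProb p σ S k x ≤ 1 := by
  induction k generalizing x with
  | zero => exact Set.indicator_le_self' (by simp) x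
  | succ k ih =>
    calc stayProb p σ S (k + 1) x ≤ ∫⁻ a, ∫⁻ x', 1 ∂(p (x, a)) ∂(σ x) :=
          lintegral_mono fun a => lintegral_mono fun x' => ih x'
      _ = 1 := by simp

theorem lintegral_stayProb_pairLaw_switch (p : Kernel (X × A) X) [IsMarkovKernel p]
    (π : Strategy X A) (x0 : X) {t : ℕ} (σ : Kernel X A) [IsMarkovKernel σ] {S : Set X}
    (hS : MeasurableSet S) (k : ℕ) {s : ℕ} (hs : t ≤ s) :
    ∫⁻ x, stayProb p σ S k x ∂(pairLaw p (π.switch t σ) x0 s).fst =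
      (pairLaw p (π.switch t σ) x0 (s + k)).fst S := by
  induction k generalizing s with
  | zero => exact lintegral_indicator_one hS
  | succ k ih =>
    have hk := measurable_stayProb p σ hS k
    have h := ih (s := s + 1) (by omega)
    rw [(isMarginalFlow_pairLaw p _ x0).succ s, Measure.lintegral_bind p.measurable.aemeasurable
      hk.aemeasurable, lintegral_pairLaw_switch p π x0 σ hs hk.lintegral_kernel] at h
    rw [show s + (k + 1) = s + 1 + k by omega, ← h]
    rfl

theorem lintegral_stayProb_of_invariant [StandardBorelSpace A] [Nonempty A]
    (p : Kernel (X × A) X) (ν : Measure (X × A)) [IsFiniteMeasure ν] (hν : ν.bind p = ν.fst)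
    {S : Set X} (hS : MeasurableSet S) (k : ℕ) :
    ∫⁻ x, stayProb p ν.condKernel S k x ∂ν.fst = ν.fst S := by
  induction k with
  | zero => exact lintegral_indicator_one hS
  | succ k ih =>
    have hk := measurable_stayProb p ν.condKernel hS k
    have hd := ν.disintegrate ν.condKernel
    have h := Measure.lintegral_compProd (μ := ν.fst) (κ := ν.condKernel)
      (hk.lintegral_kernel (κ := p))
    rw [hd, ← Measure.lintegral_bind p.measurable.aemeasurable hk.aemeasurable, hν, ih] at h
    exact h.symm

/-- A nonzero invariant measure carried by `S` that is absolutely continuous with respect to the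
state-occupation measure of a strategy yields a strategy with infinite expected time in `S`. -/
theorem exists_strategy_tsum_eq_top [StandardBorelSpace A] [Nonempty A]
    (p : Kernel (X × A) X) [IsMarkovKernel p] (π : Strategy X A) (x0 : X) {S : Set X}
    (hS : MeasurableSet S) (ν : Measure (X × A)) [IsFiniteMeasure ν] (hν : ν.bind p = ν.fst)
    (hνS : ν.fst Sᶜ = 0) (hν0 : ν ≠ 0)
    (hac : ∀ B, MeasurableSet B → (∀ t, (pairLaw p π x0 t).fst B = 0) → ν.fst B = 0) :
    ∃ π' : Strategy X A, ∑' t, (pairLaw p π' x0 t).fst S = ⊤ := by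
  set σ := ν.condKernel
  have hone : ∀ k, ∀ᵐ x ∂ν.fst, stayProb p σ S k x = 1 := by
    intro k
    have h : ∫⁻ x, stayProb p σ S k x ∂ν.fst = ∫⁻ _, 1 ∂ν.fst := by
      rw [lintegral_stayProb_of_invariant p ν hν hS, lintegral_one, measure_congr (ae_eq_univ.2 hνS)]
    exact ae_eq_of_ae_le_of_lintegral_le (Eventually.of_forall fun x => stayProb_le_one p σ S k x)
      (by rw [h]; simp) aemeasurable_const h.ge
  let B := {x | ∀ k, stayProb p σ S k x = 1}
  have hB : MeasurableSet B := by
    have : B = ⋂ k, stayProb p σ S k ⁻¹' {1} := by ext; simp [B]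
    rw [this]
    exact MeasurableSet.iInter fun k => measurable_stayProb p σ hS k (measurableSet_singleton 1)
  have hBc : ν.fst Bᶜ = 0 := ae_all_iff.2 hone
  obtain ⟨t, ht⟩ : ∃ t, (pairLaw p π x0 t).fst B ≠ 0 := by
    by_contra! h
    refine hν0 (Measure.measure_univ_eq_zero.1 ?_)
    rw [← Measure.fst_univ, ← measure_congr (ae_eq_univ.2 hBc), hac B hB h]
  refine ⟨π.switch t σ, top_le_iff.1 ?_⟩
  have hk : ∀ k, (pairLaw p π x0 t).fst B ≤ (pairLaw p (π.switch t σ) x0 (t + k)).fst S := by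
    intro k
    rw [← lintegral_stayProb_pairLaw_switch p π x0 σ hS k le_rfl, pairLaw_switch_fst,
      ← lintegral_indicator_one hB]
    refine lintegral_mono fun x => ?_
    by_cases hx : x ∈ B
    · simp [hx, hx k]
    · simp [hx]
  calc ⊤ = ∑' _ : ℕ, (pairLaw p π x0 t).fst B := (ENNReal.tsum_const_eq_top_of_ne_zero ht).symm
    _ ≤ ∑' k, (pairLaw p (π.switch t σ) x0 (t + k)).fst S := ENNReal.tsum_le_tsum hk
    _ ≤ _ := ENNReal.tsum_comp_le_tsum_of_injective (add_right_injective t)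
        fun n => (pairLaw p (π.switch t σ) x0 n).fst S

theorem le_of_forall_lintegral_nnreal_le {Ω : Type*} [TopologicalSpace Ω]
    [TopologicalSpace.PseudoMetrizableSpace Ω] [MeasurableSpace Ω] [BorelSpace Ω]
    {μ ν : Measure Ω} [IsFiniteMeasure ν]
    (h : ∀ f : BoundedContinuousFunction Ω NNReal, ∫⁻ z, f z ∂μ ≤ ∫⁻ z, f z ∂ν) : μ ≤ ν := by
  have : IsFiniteMeasure μ := ⟨by
    have := h 1
    simp only [BoundedContinuousFunction.coe_one, Pi.one_apply, ENNReal.coe_one,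
      lintegral_one] at this
    exact this.trans_lt (measure_lt_top ν _)⟩
  let _ := TopologicalSpace.pseudoMetrizableSpacePseudoMetric Ω
  refine Measure.le_iff.2 fun s hs => ?_
  rw [hs.measure_eq_iSup_isClosed_of_ne_top (measure_ne_top μ s)]
  refine iSup₂_le fun F hFs => iSup_le fun hF => ?_
  refine le_trans ?_ (measure_mono hFs)
  exact le_of_tendsto_of_tendsto' (HasOuterApproxClosed.tendsto_lintegral_apprSeq hF μ)
    (HasOuterApproxClosed.tendsto_lintegral_apprSeq hF ν) fun n => h _

theorem lintegral_sum_comap {W Z : Type*} [MeasurableSpace W] [MeasurableSpace Z] {j : W → Z}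
    (hj : MeasurableEmbedding j) (N : ℕ → Measure Z) {f : Z → ℝ≥0∞}
    (hf : ∀ z ∉ Set.range j, f z = 0) :
    ∫⁻ w, f (j w) ∂(Measure.sum fun t => (N t).comap j) = ∑' t, ∫⁻ z, f z ∂(N t) := by
  rw [lintegral_sum_measure]
  refine tsum_congr fun t => ?_
  rw [← hj.lintegral_map, hj.map_comap]
  exact setLIntegral_eq_of_support_subset fun z hz => by_contra fun h => hz (hf z h)

theorem lintegral_sum_comap_le_liminf {ι W Z : Type*} [MeasurableSpace W] [MeasurableSpace Z]
    {j : W → Z} (hj : MeasurableEmbedding j) (L : Filter ι) [L.NeBot] (M : ι → ℕ → Measure Z)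
    (M' : ℕ → Measure Z) {f : Z → ℝ≥0∞} (hf : ∀ z ∉ Set.range j, f z = 0)
    (h : ∀ t, Tendsto (fun i => ∫⁻ z, f z ∂(M i t)) L (𝓝 (∫⁻ z, f z ∂(M' t)))) :
    ∫⁻ w, f (j w) ∂(Measure.sum fun t => (M' t).comap j) ≤
      liminf (fun i => ∫⁻ w, f (j w) ∂(Measure.sum fun t => (M i t).comap j)) L := by
  simp_rw [lintegral_sum_comap hj _ hf]
  rw [ENNReal.tsum_eq_iSup_sum]
  refine iSup_le fun s => ?_
  rw [← (tendsto_finsetSum s fun t _ => h t).liminf_eq]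
  exact liminf_le_liminf (Eventually.of_forall fun i => ENNReal.sum_le_tsum s)

theorem eventually_lt_integral_of_lintegral_le_liminf {ι Ω : Type*} [MeasurableSpace Ω]
    {L : Filter ι} {μ : ι → Measure Ω} [∀ i, IsFiniteMeasure (μ i)] {μ' : Measure Ω}
    [IsFiniteMeasure μ'] {f : Ω → ℝ} (hf : Measurable f) {C : ℝ} (hC : ∀ z, |f z| ≤ C)
    (hf0 : ∀ z, 0 ≤ f z)
    (h : ∫⁻ z, ENNReal.ofReal (f z) ∂μ' ≤ liminf (fun i => ∫⁻ z, ENNReal.ofReal (f z) ∂(μ i)) L)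
    {b : ℝ} (hb : b < ∫ z, f z ∂μ') : ∀ᶠ i in L, b < ∫ z, f z ∂(μ i) := by
  have hint : ∀ (m : Measure Ω) [IsFiniteMeasure m], Integrable f m := fun m _ =>
    Integrable.of_bound hf.aestronglyMeasurable C (ae_of_all _ hC)
  rcases lt_or_ge b 0 with hb0 | hb0
  · exact Eventually.of_forall fun i => hb0.trans_le (integral_nonneg hf0)
  rw [← ofReal_integral_eq_lintegral_ofReal (hint μ') (ae_of_all _ hf0)] at h
  have hlt := ((ENNReal.ofReal_lt_ofReal_iff (hb0.trans_lt hb)).2 hb).trans_le h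
  filter_upwards [eventually_lt_of_lt_liminf hlt] with i hi
  rw [← ofReal_integral_eq_lintegral_ofReal (hint (μ i)) (ae_of_all _ hf0)] at hi
  exact (ENNReal.ofReal_lt_ofReal_iff_of_nonneg hb0).1 hi

theorem eventually_lt_integral_of_forall_add {ι Ω : Type*} [MeasurableSpace Ω]
    {L : Filter ι} {μ : ι → Measure Ω} [∀ i, IsFiniteMeasure (μ i)] {μ' : Measure Ω}
    [IsFiniteMeasure μ'] (hmass : Tendsto (fun i => (μ i).real Set.univ) L (𝓝 (μ'.real Set.univ)))
    {f : Ω → ℝ} (hf : Measurable f) {C : ℝ} (hC : ∀ z, |f z| ≤ C)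
    (h : ∫⁻ z, ENNReal.ofReal (f z + C) ∂μ' ≤
      liminf (fun i => ∫⁻ z, ENNReal.ofReal (f z + C) ∂(μ i)) L)
    {b : ℝ} (hb : b < ∫ z, f z ∂μ') : ∀ᶠ i in L, b < ∫ z, f z ∂(μ i) := by
  have hadd : ∀ (m : Measure Ω) [IsFiniteMeasure m],
      ∫ z, (f z + C) ∂m = ∫ z, f z ∂m + C * m.real Set.univ := fun m _ => by
    rw [integral_add (Integrable.of_bound hf.aestronglyMeasurable C (ae_of_all _ hC))
      (integrable_const C), integral_const, smul_eq_mul, mul_comm]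
  have h1 := eventually_lt_integral_of_lintegral_le_liminf (hf.add_const C) (C := C + C)
    (fun z => by have := abs_le.1 (hC z); exact abs_le.2 ⟨by linarith, by linarith⟩)
    (fun z => by have := abs_le.1 (hC z); linarith) h
    (b := (b + ∫ z, f z ∂μ') / 2 + C * μ'.real Set.univ) (by rw [hadd]; linarith)
  have h2 := (hmass.const_mul C).eventually_lt_const
    (show C * μ'.real Set.univ < C * μ'.real Set.univ + (∫ z, f z ∂μ' - b) / 2 by linarith)
  filter_upwards [h1, h2] with i hi1 hi2
  rw [hadd] at hi1
  linarith

theorem IsMarginalFlow.fst_sum_restrict_apply {X A : Type*} [MeasurableSpace X]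
    [MeasurableSpace A] {p : Kernel (X × A) X} {x0 : X} {M : ℕ → Measure (X × A)}
    (hM : IsMarginalFlow p x0 M) {S : Set X} (hpS : ∀ x ∉ S, ∀ a, p (x, a) S = 0)
    {B : Set X} (hB : MeasurableSet B) (hBS : B ⊆ S) :
    (Measure.sum fun t => (M t).restrict (Prod.fst ⁻¹' S)).fst B =
      Measure.dirac x0 B + ((Measure.sum fun t => (M t).restrict (Prod.fst ⁻¹' S)).bind p) B := by
  have h1 : ∀ t, (M t).restrict (Prod.fst ⁻¹' S) (Prod.fst ⁻¹' B) = (M t).fst B := fun t => by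
    rw [Measure.restrict_apply (measurable_fst hB), Measure.fst_apply hB,
      Set.inter_eq_left.2 (Set.preimage_mono hBS)]
  have h2 : ∀ t, ∫⁻ z, p z B ∂((M t).restrict (Prod.fst ⁻¹' S)) = ((M t).bind p) B := fun t => by
    rw [Measure.bind_apply hB p.measurable.aemeasurable]
    exact setLIntegral_eq_of_support_subset fun z hz => by_contra fun h =>
      hz (measure_mono_null hBS (hpS z.1 h z.2))
  rw [Measure.bind_apply hB p.measurable.aemeasurable, lintegral_sum_measure, Measure.fst_apply hB,
    Measure.sum_apply _ (measurable_fst hB)]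
  simp_rw [h1, h2]
  rw [tsum_eq_zero_add' ENNReal.summable, hM.zero]
  simp_rw [hM.succ]

theorem bind_eq_fst_of_forall_subset {X A : Type*} [MeasurableSpace X]
    [MeasurableSpace A] {p : Kernel (X × A) X} [IsMarkovKernel p] {ν : Measure (X × A)}
    [IsFiniteMeasure ν] {S : Set X} (hS : MeasurableSet S) (hνS : ν.fst Sᶜ = 0)
    (h : ∀ B, MeasurableSet B → B ⊆ S → (ν.bind p) B = ν.fst B) : ν.bind p = ν.fst := by
  have huniv : (ν.bind p) Set.univ = ν.fst Set.univ := by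
    rw [Measure.bind_apply .univ p.measurable.aemeasurable, Measure.fst_univ]
    simp
  have hc : (ν.bind p) Sᶜ = 0 := by
    rw [← measure_add_measure_compl hS, ← measure_add_measure_compl (μ := ν.fst) hS, hνS,
      h S hS subset_rfl] at huniv
    exact (ENNReal.add_right_inj (measure_ne_top _ _)).1 huniv
  ext B hB
  rw [← measure_inter_add_sdiff B hS, ← measure_inter_add_sdiff (μ := ν.fst) B hS,
    h _ (hB.inter hS) Set.inter_subset_right,
    measure_mono_null (fun x hx => hx.2 : B \ S ⊆ Sᶜ) hc,
    measure_mono_null (fun x hx => hx.2 : B \ S ⊆ Sᶜ) hνS]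

theorem sum_restrict_eq_of_le [StandardBorelSpace A] [Nonempty A] (p : Kernel (X × A) X)
    [IsMarkovKernel p] (π : Strategy X A) (x0 : X) {S : Set X} (hS : MeasurableSet S)
    (hpS : ∀ x ∉ S, ∀ a, p (x, a) S = 0)
    (habs : ∀ π' : Strategy X A, ∑' t, (pairLaw p π' x0 t).fst S < ⊤)
    {M : ℕ → Measure (X × A)} (hM : IsMarginalFlow p x0 M) {E E' : Measure (X × A)}
    [IsFiniteMeasure E]
    (hE : E = Measure.sum fun t => (pairLaw p π x0 t).restrict (Prod.fst ⁻¹' S))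
    (hE' : E' = Measure.sum fun t => (M t).restrict (Prod.fst ⁻¹' S)) (hle : E' ≤ E) :
    E' = E := by
  have : IsFiniteMeasure E' := isFiniteMeasure_of_le E hle
  obtain ⟨ν, hν⟩ : ∃ ν, ν = E - E' := ⟨_, rfl⟩
  have hadd : ν + E' = E := by rw [hν, Measure.sub_add_cancel_of_le hle]
  have hνE : ν ≤ E := hν ▸ Measure.sub_le
  have : IsFiniteMeasure ν := isFiniteMeasure_of_le E hνE
  have hfle : ∀ B, MeasurableSet B → ν.fst B ≤ E.fst B := fun B hB => by
    rw [Measure.fst_apply hB, Measure.fst_apply hB]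
    exact hνE _
  have hEfst : ∀ B, MeasurableSet B →
      E.fst B = ∑' t, (pairLaw p π x0 t) (Prod.fst ⁻¹' (B ∩ S)) := fun B hB => by
    rw [Measure.fst_apply hB, hE, Measure.sum_apply _ (measurable_fst hB)]
    exact tsum_congr fun t => Measure.restrict_apply (measurable_fst hB)
  have hνS : ν.fst Sᶜ = 0 := by
    refine le_antisymm ((hfle _ hS.compl).trans ?_) bot_le
    rw [hEfst _ hS.compl]
    simp
  have hinv : ν.bind p = ν.fst := by
    refine bind_eq_fst_of_forall_subset hS hνS fun B hB hBS => ?_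
    have h1 := (isMarginalFlow_pairLaw p π x0).fst_sum_restrict_apply hpS hB hBS
    have h2 := hM.fst_sum_restrict_apply hpS hB hBS
    rw [← hE] at h1
    rw [← hE'] at h2
    have h3 : E.fst B = ν.fst B + E'.fst B := by
      rw [← hadd, Measure.fst_apply hB, Measure.fst_apply hB, Measure.fst_apply hB,
        Measure.add_apply]
    have h4 : (E.bind p) B = (ν.bind p) B + (E'.bind p) B := by
      rw [← hadd, Measure.bind_apply hB p.measurable.aemeasurable,
        Measure.bind_apply hB p.measurable.aemeasurable,
        Measure.bind_apply hB p.measurable.aemeasurable, lintegral_add_measure]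
    rw [h3, h4, h2] at h1
    have hfin : Measure.dirac x0 B + (E'.bind p) B ≠ ⊤ := h2 ▸ measure_ne_top _ _
    rw [add_left_comm (Measure.dirac x0 B)] at h1
    exact ((ENNReal.add_left_inj hfin).1 h1).symm
  by_cases hν0 : ν = 0
  · rw [← hadd, hν0, zero_add]
  obtain ⟨π', hπ'⟩ := exists_strategy_tsum_eq_top p π x0 hS ν hinv hνS hν0 fun B hB h => by
    refine le_antisymm ((hfle B hB).trans ?_) bot_le
    rw [hEfst B hB, nonpos_iff_eq_zero, ENNReal.tsum_eq_zero]
    intro t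
    refine measure_mono_null (Set.preimage_mono Set.inter_subset_left) ?_
    rw [← Measure.fst_apply hB]
    exact h t
  exact absurd hπ' (habs π').ne

/-- The embedding of `Y × A` into the state-action space with cemetery. -/
def inlPair : Y × A → (Y ⊕ Unit) × A := Prod.map Sum.inl id

theorem measurableEmbedding_inlPair : MeasurableEmbedding (inlPair : Y × A → (Y ⊕ Unit) × A) :=
  MeasurableEmbedding.prodMap
    ⟨Sum.inl_injective, measurable_inl, fun _ hs => measurableSet_inl_image.2 hs⟩ .id

theorem range_inlPair {Y A : Type*} :
    Set.range (inlPair : Y × A → (Y ⊕ Unit) × A) = Prod.fst ⁻¹' Set.range Sum.inl := by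
  rw [inlPair, Set.range_prodMap, Set.range_id, Set.prod_univ]

theorem map_inlPair_sum_comap (N : ℕ → Measure ((Y ⊕ Unit) × A)) :
    (Measure.sum fun t => (N t).comap inlPair).map inlPair =
      Measure.sum fun t => (N t).restrict (Prod.fst ⁻¹' Set.range Sum.inl) := by
  rw [Measure.map_sum measurableEmbedding_inlPair.measurable.aemeasurable]
  simp_rw [measurableEmbedding_inlPair.map_comap, range_inlPair]

/-- A function on `Y × A`, extended by zero at the cemetery. -/
def extendZero (g : Y × A → ℝ) (z : (Y ⊕ Unit) × A) : ℝ :=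
  Sum.elim (fun y => g (y, z.2)) (fun _ => 0) z.1

theorem measurable_extendZero {g : Y × A → ℝ} (hg : Measurable g) :
    Measurable (extendZero g) := by
  have h : extendZero g = Sum.elim g (fun _ => 0) ∘ MeasurableEquiv.sumProdDistrib Y Unit A := by
    funext ⟨x, a⟩
    cases x <;> rfl
  rw [h]
  exact (hg.sumElim measurable_const).comp (MeasurableEquiv.measurable _)

theorem lintegral_limit_le_liminf {ι : Type*} {L : Filter ι} [L.NeBot]
    {M : ι → ℕ → Measure ((Y ⊕ Unit) × A)} {M' : ℕ → Measure ((Y ⊕ Unit) × A)}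
    (hM : ∀ i t, IsProbabilityMeasure (M i t)) (hM' : ∀ t, IsProbabilityMeasure (M' t))
    [TopologicalSpace A]
    (h : ∀ t, ∀ g : (Y ⊕ Unit) × A → ℝ, Measurable g → (∃ C, ∀ z, |g z| ≤ C) →
      (∀ x, Continuous fun a => g (x, a)) →
      Tendsto (fun i => ∫ z, g z ∂(M i t)) L (𝓝 (∫ z, g z ∂(M' t))))
    {g : Y × A → ℝ} (hg : Measurable g) {C : ℝ} (hC : ∀ z, |g z| ≤ C) (hg0 : ∀ z, 0 ≤ g z)
    (hgc : ∀ y, Continuous fun a => g (y, a)) :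
    ∫⁻ z, ENNReal.ofReal (g z) ∂(Measure.sum fun t => (M' t).comap inlPair) ≤
      liminf (fun i => ∫⁻ z, ENNReal.ofReal (g z) ∂(Measure.sum fun t => (M i t).comap inlPair))
        L := by
  have hG := measurable_extendZero hg
  have hG0 : ∀ z, 0 ≤ extendZero g z := by
    rintro ⟨y | _, a⟩
    exacts [hg0 (y, a), le_rfl]
  have hGC : ∀ z, |extendZero g z| ≤ max C 0 := by
    rintro ⟨y | _, a⟩
    · exact (hC (y, a)).trans (le_max_left _ _)
    · simp [extendZero]
  refine lintegral_sum_comap_le_liminf measurableEmbedding_inlPair L M M'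
    (f := fun z => ENNReal.ofReal (extendZero g z)) ?_ fun t => ?_
  · rintro ⟨y | _, a⟩ hz
    · exact absurd ⟨(y, a), rfl⟩ hz
    · simp [extendZero]
  · have hint : ∀ m : Measure ((Y ⊕ Unit) × A), IsProbabilityMeasure m →
        ∫⁻ z, ENNReal.ofReal (extendZero g z) ∂m = ENNReal.ofReal (∫ z, extendZero g z ∂m) :=
      fun m _ => (ofReal_integral_eq_lintegral_ofReal
        (Integrable.of_bound hG.aestronglyMeasurable _ (ae_of_all _ hGC)) (ae_of_all _ hG0)).symm
    rw [hint _ (hM' t)]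
    simp_rw [fun i => hint _ (hM i t)]
    refine (ENNReal.continuous_ofReal.tendsto _).comp (h t _ hG ⟨_, hGC⟩ ?_)
    rintro (y | _)
    exacts [hgc y, continuous_const]

theorem tendsto_nhds_wTop_iff {ι Ω : Type*} [TopologicalSpace Ω] [MeasurableSpace Ω]
    {L : Filter ι} {η : ι → FiniteMeasure Ω} {η' : FiniteMeasure Ω} :
    Tendsto η L (@nhds _ (wTop Ω) η') ↔ ∀ g : Ω → ℝ, Continuous g → (∃ C, ∀ z, |g z| ≤ C) →
      Tendsto (fun i => ∫ z, g z ∂(η i : Measure Ω)) L (𝓝 (∫ z, g z ∂(η' : Measure Ω))) := by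
  unfold wTop
  simp only [nhds_iInf, nhds_induced, tendsto_iInf, tendsto_comap_iff]
  rfl

theorem tendsto_nhds_wsTop_iff {ι Y A : Type*} [MeasurableSpace Y] [TopologicalSpace A]
    [MeasurableSpace A] {L : Filter ι} {η : ι → FiniteMeasure (Y × A)}
    {η' : FiniteMeasure (Y × A)} :
    Tendsto η L (@nhds _ (wsTop Y A) η') ↔ ∀ g : Y × A → ℝ, Measurable g →
      (∃ C, ∀ z, |g z| ≤ C) → (∀ y, Continuous fun a => g (y, a)) →
      Tendsto (fun i => ∫ z, g z ∂(η i : Measure (Y × A))) L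
        (𝓝 (∫ z, g z ∂(η' : Measure (Y × A)))) := by
  unfold wsTop
  simp only [nhds_iInf, nhds_induced, tendsto_iInf, tendsto_comap_iff]
  rfl

/-- Along an ultrafilter, weak convergence of occupation measures of an absorbing model to an
occupation measure forces convergence against every bounded Caratheodory function. -/
theorem tendsto_integral_occupation {ι Y A : Type*}
    [TopologicalSpace Y] [MeasurableSpace Y] [BorelSpace Y]
    [TopologicalSpace.MetrizableSpace Y] [SecondCountableTopology Y] [StandardBorelSpace Y]
    [TopologicalSpace A] [MeasurableSpace A] [BorelSpace A] [CompactSpace A]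
    [TopologicalSpace.MetrizableSpace A] [SecondCountableTopology A] [StandardBorelSpace A]
    [Nonempty A]
    (p : Kernel ((Y ⊕ Unit) × A) (Y ⊕ Unit)) [IsMarkovKernel p]
    (hcem : ∀ a : A, p (Sum.inr (), a) {(Sum.inr () : Y ⊕ Unit)} = 1)
    (x0 : Y ⊕ Unit) (habs : IsAbsorbing p x0)
    (hp : ∀ g : Y ⊕ Unit → ℝ, Measurable g → (∃ C, ∀ x, |g x| ≤ C) →
      ∀ x, Continuous fun a : A => ∫ y, g y ∂(p (x, a)))
    (U : Ultrafilter ι) (π : ι → Strategy (Y ⊕ Unit) A) (π' : Strategy (Y ⊕ Unit) A)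
    [∀ i, IsFiniteMeasure (occupation p (π i) x0)] [IsFiniteMeasure (occupation p π' x0)]
    (hw : ∀ g : Y × A → ℝ, Continuous g → (∃ C, ∀ z, |g z| ≤ C) →
      Tendsto (fun i => ∫ z, g z ∂(occupation p (π i) x0)) U (𝓝 (∫ z, g z ∂(occupation p π' x0))))
    {g : Y × A → ℝ} (hg : Measurable g) (hgC : ∃ C, ∀ z, |g z| ≤ C)
    (hgc : ∀ y, Continuous fun a => g (y, a)) :
    Tendsto (fun i => ∫ z, g z ∂(occupation p (π i) x0)) U
      (𝓝 (∫ z, g z ∂(occupation p π' x0))) := by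
  have := standardBorelSpace_sum (α := Y) (β := Unit)
  obtain ⟨M', hM', hlim⟩ := exists_marginalFlow_limit p hp x0 U (fun i => pairLaw p (π i) x0)
    fun i => isMarginalFlow_pairLaw p (π i) x0
  have hle : ∀ {g : Y × A → ℝ}, Measurable g → ∀ {C : ℝ}, (∀ z, |g z| ≤ C) → (∀ z, 0 ≤ g z) →
      (∀ y, Continuous fun a => g (y, a)) →
      ∫⁻ z, ENNReal.ofReal (g z) ∂(Measure.sum fun t => (M' t).comap inlPair) ≤
        liminf (fun i => ∫⁻ z, ENNReal.ofReal (g z) ∂(occupation p (π i) x0)) U :=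
    fun hg _ hC hg0 hgc => lintegral_limit_le_liminf
      (fun i => (isMarginalFlow_pairLaw p (π i) x0).prob) hM'.prob hlim hg hC hg0 hgc
  have hsub : (Measure.sum fun t => (M' t).comap inlPair) ≤ occupation p π' x0 := by
    refine le_of_forall_lintegral_nnreal_le fun f => ?_
    have hC : ∀ z, |(f z : ℝ)| ≤ nndist f 0 := fun z => by
      rw [NNReal.abs_eq]
      exact BoundedContinuousFunction.NNReal.upper_bound f z
    have hfc : Continuous fun z => (f z : ℝ) := NNReal.continuous_coe.comp f.continuous
    have hint : ∀ (m : Measure (Y × A)) [IsFiniteMeasure m],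
        ∫⁻ z, f z ∂m = ENNReal.ofReal (∫ z, (f z : ℝ) ∂m) := fun m _ => by
      rw [ofReal_integral_eq_lintegral_ofReal (Integrable.of_bound
        hfc.measurable.aestronglyMeasurable _ (ae_of_all _ hC)) (ae_of_all _ fun z => (f z).2)]
      simp
    have h1 := hle hfc.measurable hC (fun z => (f z).2) fun y => by fun_prop
    simp only [ENNReal.ofReal_coe_nnreal] at h1
    have h2 := ((ENNReal.continuous_ofReal.tendsto _).comp (hw _ hfc ⟨_, hC⟩)).liminf_eq
    simp only [Function.comp_def, ← hint] at h2
    exact h1.trans h2.le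
  have heq : (Measure.sum fun t => (M' t).comap inlPair) = occupation p π' x0 := by
    have hfst : ∀ π'' : Strategy (Y ⊕ Unit) A, ∀ t,
        (pairLaw p π'' x0 t).fst (Set.range Sum.inl) = survive p π'' x0 t := fun π'' t => by
      rw [Measure.fst_apply measurableSet_range_inl, survive]
      congr 1
      ext z
      exact exists_congr fun y => eq_comm
    have hmap : (Measure.sum fun t => (M' t).comap inlPair).map inlPair =
        (occupation p π' x0).map inlPair := by
      refine sum_restrict_eq_of_le p π' x0 measurableSet_range_inl ?_ ?_ hM'
        (map_inlPair_sum_comap (pairLaw p π' x0)) (map_inlPair_sum_comap M')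
        (Measure.map_mono hsub measurableEmbedding_inlPair.measurable)
      · rintro (y | _) hx a
        · exact absurd ⟨y, rfl⟩ hx
        · have h := (prob_compl_eq_zero_iff (μ := p (Sum.inr (), a))
            (measurableSet_singleton (Sum.inr () : Y ⊕ Unit))).2 (hcem a)
          refine measure_mono_null ?_ h
          rintro _ ⟨y, rfl⟩
          simp
      · intro π''
        simp_rw [hfst]
        exact habs π''
    rw [← measurableEmbedding_inlPair.comap_map (Measure.sum fun t => (M' t).comap inlPair), hmap,
      measurableEmbedding_inlPair.comap_map]
  rw [heq] at hle
  obtain ⟨C, hC⟩ := hgC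
  have hmass : Tendsto (fun i => (occupation p (π i) x0).real Set.univ) U
      (𝓝 ((occupation p π' x0).real Set.univ)) := by
    simpa using hw (fun _ => 1) continuous_const ⟨1, by simp⟩
  have hlow : ∀ {g : Y × A → ℝ}, Measurable g → (∀ z, |g z| ≤ C) →
      (∀ y, Continuous fun a => g (y, a)) → ∀ b < ∫ z, g z ∂(occupation p π' x0),
      ∀ᶠ i in (U : Filter ι), b < ∫ z, g z ∂(occupation p (π i) x0) := fun hg hC hgc b hb =>
    eventually_lt_integral_of_forall_add hmass hg hC (hle (hg.add_const C) (C := C + C)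
      (fun z => by have := abs_le.1 (hC z); exact abs_le.2 ⟨by linarith, by linarith⟩)
      (fun z => by have := abs_le.1 (hC z); linarith) fun y => (hgc y).add continuous_const) hb
  refine tendsto_order.2 ⟨hlow hg hC hgc, fun b hb => ?_⟩
  have h := hlow hg.neg (fun z => by simpa using hC z) (fun y => (hgc y).neg) (-b)
    (by simpa [integral_neg] using hb)
  simpa [integral_neg] using h

/-- Proposition of the paper.  Under Condition (S), for an absorbing MDP model
with initial state `x0`, a sequence in `D^Π_{x0}` converges to an element of `D^Π_{x0}` in the
w-topology iff it converges to it in the ws-topology. -/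
theorem stmt2
    {Y A : Type*}
    [TopologicalSpace Y] [MeasurableSpace Y] [BorelSpace Y]
    [TopologicalSpace.MetrizableSpace Y] [SecondCountableTopology Y] [StandardBorelSpace Y]
    [Nonempty Y]
    [TopologicalSpace A] [MeasurableSpace A] [BorelSpace A]
    [TopologicalSpace.MetrizableSpace A] [SecondCountableTopology A] [StandardBorelSpace A]
    [Nonempty A]
    (p : Kernel ((Y ⊕ Unit) × A) (Y ⊕ Unit)) [IsMarkovKernel p]
    (hcem : ∀ a : A, p (Sum.inr (), a) {(Sum.inr () : Y ⊕ Unit)} = 1)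
    (x0 : Y ⊕ Unit)
    (habs : IsAbsorbing p x0)
    (hS : ConditionS p)
    (η : ℕ → FiniteMeasure (Y × A)) (hη : ∀ n, η n ∈ OccSet p Set.univ x0)
    (ηlim : FiniteMeasure (Y × A)) (hηlim : ηlim ∈ OccSet p Set.univ x0) :
    Tendsto η atTop (@nhds _ (wTop (Y × A)) ηlim) ↔
      Tendsto η atTop (@nhds _ (wsTop Y A) ηlim) := by
  rw [tendsto_nhds_wTop_iff, tendsto_nhds_wsTop_iff]
  refine ⟨fun hw g hg hgC hgc => ?_, fun hws g hg hgC =>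
    hws g hg.measurable hgC fun y => hg.comp (Continuous.prodMk_right y)⟩
  have := hS.1
  choose π _ hπ using hη
  obtain ⟨π', -, hπ'⟩ := hηlim
  have (n : ℕ) : IsFiniteMeasure (occupation p (π n) x0) := hπ n ▸ inferInstance
  have : IsFiniteMeasure (occupation p π' x0) := hπ' ▸ inferInstance
  simp_rw [hπ, hπ'] at hw ⊢
  refine (tendsto_iff_ultrafilter _ _ _).2 fun U hU => ?_
  exact tendsto_integral_occupation p hcem x0 habs hS.2 U π π'
    (fun g hg hgC => (hw g hg hgC).mono_left hU) hg hgC hgc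

end
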